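/- Let λ̄ be finite with A + λ̄B ⪰ 0, (a + λ̄b) ∈ Range(A + λ̄B), and vᵀBv < 0 for all nonzero v ∈ Null(A + λ̄B). Let x₀ be any solution of (A + λ̄B)x = -(a + λ̄b) and suppose g(x₀) ≥ 0, where g(x) = xᵀBx + 2bᵀx + β. Then for any nonzero v ∈ Null(A + λ̄B) there exists α ∈ ℝ such that x* = x₀ + αv satisfies (A + λ̄B)x* = -(a + λ̄b) and g(x*) = 0. -/

import Mathlib

open Matrix

theorem stmt9 {n : ℕ} (A B : Matrix (Fin n) (Fin n) ℝ) (a b : Fin n → ℝ) (β : ℝ)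
    (hA : A.IsSymm) (hB : B.IsSymm)
    (lbar : ℝ) (hpsd : (A + lbar • B).PosSemidef)
    (hneg : ∀ w : Fin n → ℝ, w ≠ 0 → (A + lbar • B).mulVec w = 0 →
      w ⬝ᵥ B.mulVec w < 0)
    (g : (Fin n → ℝ) → ℝ) (hg : ∀ x, g x = x ⬝ᵥ B.mulVec x + 2 * (b ⬝ᵥ x) + β)
    (x0 : Fin n → ℝ) (hx0 : (A + lbar • B).mulVec x0 = -(a + lbar • b))
    (hg0 : 0 ≤ g x0)
    (v : Fin n → ℝ) (hv : v ≠ 0) (hvnull : (A + lbar • B).mulVec v = 0) :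
    ∃ α : ℝ, (A + lbar • B).mulVec (x0 + α • v) = -(a + lbar • b) ∧
      g (x0 + α • v) = 0 := by
  have hp := hneg v hv hvnull
  have hexp : ∀ α : ℝ, g (x0 + α • v) = (v ⬝ᵥ B.mulVec v) * (α * α)
      + (x0 ⬝ᵥ B.mulVec v + v ⬝ᵥ B.mulVec x0 + 2 * (b ⬝ᵥ v)) * α + g x0 := by
    intro α
    rw [hg, hg]
    simp only [Matrix.mulVec_add, Matrix.mulVec_smul, add_dotProduct, dotProduct_add,
      smul_dotProduct, dotProduct_smul, smul_eq_mul]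
    ring
  have hd : 0 ≤ discrim (v ⬝ᵥ B.mulVec v)
      (x0 ⬝ᵥ B.mulVec v + v ⬝ᵥ B.mulVec x0 + 2 * (b ⬝ᵥ v)) (g x0) := by
    unfold discrim
    nlinarith [sq_nonneg (x0 ⬝ᵥ B.mulVec v + v ⬝ᵥ B.mulVec x0 + 2 * (b ⬝ᵥ v)),
      mul_nonneg (neg_nonneg.mpr hp.le) hg0]
  obtain ⟨α, hα⟩ := exists_quadratic_eq_zero hp.ne ⟨_, (Real.mul_self_sqrt hd).symm⟩
  refine ⟨α, ?_, ?_⟩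
  · rw [Matrix.mulVec_add, Matrix.mulVec_smul, hvnull, hx0, smul_zero, add_zero]
  · rw [hexp, hα]
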